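/- Let Λ be a finitely aligned k-graph and let 𝓔 ⊆ FE(Λ) be satiated. Suppose E ∈ 𝓔 and F ⊆ r(E)Λ \ Λ⁰ is finite and satisfies: for every μ ∈ E, either μ ∈ FΛ or Ext(μ;F) ∈ 𝓔. Then F ∈ 𝓔. -/

import Mathlib

open scoped ENNReal

attribute [local instance] Classical.propDecidable

/-- Product of `f` over a set `S`, in some arbitrary order (junk value `1` if `S` is
infinite).  Used for products of commuting projections. -/
noncomputable def listProd {ι A : Type*} [Monoid A] (S : Set ι) (f : ι → A) : A :=
  if h : S.Finite then (h.toFinset.toList.map f).prod else 1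

/-- A `k`-graph: a countable category `Λ` (whose morphisms are the terms of `Path`, with
vertices identified with the morphisms of degree `0`) together with a degree functor
`d : Λ → ℕ^k` satisfying the factorisation property. -/
structure KGraph (k : ℕ) where
  Path : Type
  countable : Countable Path
  d : Path → Fin k → ℕ
  r : Path → Path
  s : Path → Path
  comp : Path → Path → Path
  d_r : ∀ lam, d (r lam) = 0
  d_s : ∀ lam, d (s lam) = 0
  r_r : ∀ lam, r (r lam) = r lam
  s_r : ∀ lam, s (r lam) = r lam
  r_s : ∀ lam, r (s lam) = s lam
  s_s : ∀ lam, s (s lam) = s lam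
  comp_source : ∀ lam, comp lam (s lam) = lam
  range_comp : ∀ lam, comp (r lam) lam = lam
  r_comp : ∀ lam mu, s lam = r mu → r (comp lam mu) = r lam
  s_comp : ∀ lam mu, s lam = r mu → s (comp lam mu) = s mu
  d_comp : ∀ lam mu, s lam = r mu → d (comp lam mu) = d lam + d mu
  comp_assoc : ∀ lam mu nu, s lam = r mu → s mu = r nu →
    comp (comp lam mu) nu = comp lam (comp mu nu)
  factor : ∀ lam m n, d lam = m + n →
    ∃! p : Path × Path, s p.1 = r p.2 ∧ d p.1 = m ∧ d p.2 = n ∧ comp p.1 p.2 = lam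

namespace KGraph

variable {k : ℕ} (Λ : KGraph k)

/-- Vertices are identified with the paths of degree `0`. -/
def IsVertex (v : Λ.Path) : Prop := Λ.d v = 0

/-- The unique factorisation of `lam` as a product of a path of degree `m` and the
remaining tail (junk value if `¬ m ≤ d lam`). -/
noncomputable def split (lam : Λ.Path) (m : Fin k → ℕ) : Λ.Path × Λ.Path :=
  if h : m ≤ Λ.d lam then
    (Λ.factor lam m (Λ.d lam - m) (by
      funext i
      exact (Nat.add_sub_cancel' (h i)).symm)).choose
  else (lam, lam)

/-- The segment `λ(m,n)` of the path `λ`: the unique path of degree `n - m` such that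
`λ = λ(0,m) λ(m,n) λ(n, d λ)` (meaningful for `m ≤ n ≤ d λ`). -/
noncomputable def seg (lam : Λ.Path) (m n : Fin k → ℕ) : Λ.Path :=
  (Λ.split (Λ.split lam n).1 m).2

/-- `MCE(μ,ν)`: minimal common extensions of `μ` and `ν`. -/
def MCE (mu nu : Λ.Path) : Set Λ.Path :=
  {lam | Λ.d lam = Λ.d mu ⊔ Λ.d nu ∧ Λ.seg lam 0 (Λ.d mu) = mu ∧ Λ.seg lam 0 (Λ.d nu) = nu}

/-- `Λ^min(μ,ν) = {(α,β) : μα = νβ ∈ MCE(μ,ν)}`. -/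
def Lmin (mu nu : Λ.Path) : Set (Λ.Path × Λ.Path) :=
  {p | Λ.s mu = Λ.r p.1 ∧ Λ.s nu = Λ.r p.2 ∧ Λ.comp mu p.1 = Λ.comp nu p.2 ∧
    Λ.comp mu p.1 ∈ Λ.MCE mu nu}

/-- `Ext(μ;E)`: extensions of `μ` with respect to `E`. -/
def Ext (mu : Λ.Path) (E : Set Λ.Path) : Set Λ.Path :=
  {a | Λ.r a = Λ.s mu ∧ ∃ nu ∈ E, ∃ b, (a, b) ∈ Λ.Lmin mu nu}

/-- `Λ` is finitely aligned if all the sets `MCE(μ,ν)` are finite. -/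
def FinitelyAligned : Prop := ∀ mu nu, (Λ.MCE mu nu).Finite

/-- `E ⊆ vΛ` is exhaustive if `Ext(λ;E) ≠ ∅` for all `λ ∈ vΛ`. -/
def Exhaustive (v : Λ.Path) (E : Set Λ.Path) : Prop :=
  ∀ lam, Λ.r lam = v → (Λ.Ext lam E).Nonempty

/-- `E ∈ vFE(Λ)`: `E ⊆ vΛ \ {v}` is finite and exhaustive (so `r(E) = v`). -/
def FEat (v : Λ.Path) (E : Set Λ.Path) : Prop :=
  Λ.IsVertex v ∧ (∀ lam ∈ E, Λ.r lam = v ∧ lam ≠ v) ∧ E.Finite ∧ Λ.Exhaustive v E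

/-- `FE(Λ)`: the finite exhaustive sets. -/
def FE : Set (Set Λ.Path) := {E | ∃ v, Λ.FEat v E}

/-- `λE = {λμ : μ ∈ E, r(μ) = s(λ)}`. -/
def lamSet (lam : Λ.Path) (E : Set Λ.Path) : Set Λ.Path :=
  {x | ∃ mu ∈ E, Λ.s lam = Λ.r mu ∧ Λ.comp lam mu = x}

/-- `EΛ = {λμ : λ ∈ E, r(μ) = s(λ)}`. -/
def setLam (E : Set Λ.Path) : Set Λ.Path :=
  {x | ∃ lam ∈ E, ∃ mu, Λ.s lam = Λ.r mu ∧ Λ.comp lam mu = x}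

/-- `𝓔 ⊆ FE(Λ)` is satiated if it satisfies (S1)--(S4). -/
def Satiated (𝓔 : Set (Set Λ.Path)) : Prop :=
  𝓔 ⊆ Λ.FE ∧
  (∀ G ∈ 𝓔, ∀ E ∈ Λ.FE, G ⊆ E → E ∈ 𝓔) ∧
  (∀ G ∈ 𝓔, ∀ v, Λ.FEat v G → ∀ mu, Λ.r mu = v → mu ∉ Λ.setLam G → Λ.Ext mu G ∈ 𝓔) ∧
  (∀ G ∈ 𝓔, ∀ n : Λ.Path → Fin k → ℕ, (∀ lam ∈ G, 0 < n lam ∧ n lam ≤ Λ.d lam) →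
    ((fun lam => Λ.seg lam 0 (n lam)) '' G) ∈ 𝓔) ∧
  (∀ G ∈ 𝓔, ∀ G' ⊆ G, ∀ Gl : Λ.Path → Set Λ.Path,
    (∀ lam ∈ G', Gl lam ∈ 𝓔 ∧ Λ.FEat (Λ.s lam) (Gl lam)) →
    ((G \ G') ∪ ⋃ lam ∈ G', Λ.lamSet lam (Gl lam)) ∈ 𝓔)

/-- The satiation `𝓔̄` of `𝓔`: the smallest satiated subset of `FE(Λ)` containing `𝓔`. -/
def satiation (𝓔 : Set (Set Λ.Path)) : Set (Set Λ.Path) :=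
  ⋂₀ {F | 𝓔 ⊆ F ∧ Λ.Satiated F}

/-- `ΠE`: the smallest subset of `Λ` containing `E` which is closed under the operation
`(λ,μ,σ) ↦ λ Ext(μ;{σ})` for `λ,μ,σ ∈ ΠE` with `d(λ) = d(μ)`, `s(λ) = s(μ)`. -/
def PiSet (E : Set Λ.Path) : Set Λ.Path :=
  ⋂₀ {G | E ⊆ G ∧ ∀ lam mu sig, lam ∈ G → mu ∈ G → sig ∈ G →
    Λ.d lam = Λ.d mu → Λ.s lam = Λ.s mu → Λ.lamSet lam (Λ.Ext mu {sig}) ⊆ G}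

/-- `Σ₁(𝓔)`: finite sets `F ⊆ r(E)Λ \ Λ⁰` containing some `E ∈ 𝓔`. -/
def Sig1 (𝓔 : Set (Set Λ.Path)) : Set (Set Λ.Path) :=
  {F | ∃ E ∈ 𝓔, ∃ v, Λ.FEat v E ∧ E ⊆ F ∧ F.Finite ∧
    ∀ lam ∈ F, Λ.r lam = v ∧ ¬ Λ.IsVertex lam}

/-- `Σ₂(𝓔) = {Ext(μ;E) : E ∈ 𝓔, μ ∈ r(E)Λ \ EΛ}`. -/
def Sig2 (𝓔 : Set (Set Λ.Path)) : Set (Set Λ.Path) :=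
  {F | ∃ E ∈ 𝓔, ∃ v, Λ.FEat v E ∧ ∃ mu, Λ.r mu = v ∧ mu ∉ Λ.setLam E ∧ F = Λ.Ext mu E}

/-- `Σ₃(𝓔) = {{λ(0,n_λ) : λ ∈ E} : E ∈ 𝓔, 0 < n_λ ≤ d(λ)}`. -/
def Sig3 (𝓔 : Set (Set Λ.Path)) : Set (Set Λ.Path) :=
  {F | ∃ E ∈ 𝓔, ∃ n : Λ.Path → Fin k → ℕ, (∀ lam ∈ E, 0 < n lam ∧ n lam ≤ Λ.d lam) ∧
    F = (fun lam => Λ.seg lam 0 (n lam)) '' E}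

/-- `Σ₄(𝓔) = {(E \ F) ∪ ⋃_{λ ∈ F} λ F_λ : E ∈ 𝓔, F ⊆ E, F_λ ∈ s(λ)𝓔}`. -/
def Sig4 (𝓔 : Set (Set Λ.Path)) : Set (Set Λ.Path) :=
  {G | ∃ E ∈ 𝓔, ∃ F ⊆ E, ∃ Fl : Λ.Path → Set Λ.Path,
    (∀ lam ∈ F, Fl lam ∈ 𝓔 ∧ Λ.FEat (Λ.s lam) (Fl lam)) ∧
    G = (E \ F) ∪ ⋃ lam ∈ F, Λ.lamSet lam (Fl lam)}

/-- `Σ = Σ₄ ∘ Σ₃ ∘ Σ₂ ∘ Σ₁`. -/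
def SigmaStep (𝓔 : Set (Set Λ.Path)) : Set (Set Λ.Path) :=
  Λ.Sig4 (Λ.Sig3 (Λ.Sig2 (Λ.Sig1 𝓔)))

/-- `Σ^∞(𝓔) = ⋃_{n ≥ 1} Σ^n(𝓔)`. -/
def SigmaInf (𝓔 : Set (Set Λ.Path)) : Set (Set Λ.Path) :=
  ⋃ n : ℕ, (Λ.SigmaStep)^[n + 1] 𝓔

section StarAlgebra

variable {A : Type*} [Ring A] [StarRing A]

/-- The product `∏_{λ ∈ E} (t_v - t_λ t_λ*)` (the factors pairwise commute for any
family satisfying (TCK1)--(TCK3), so the implicit choice of ordering is immaterial). -/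
noncomputable def gapProd (t : Λ.Path → A) (v : Λ.Path) (E : Set Λ.Path) : A :=
  listProd E fun lam => t v - t lam * star (t lam)

/-- Conditions (TCK1)--(TCK3) on a family `{t_λ}`. -/
def TCKFamily (t : Λ.Path → A) : Prop :=
  (∀ v, Λ.IsVertex v → star (t v) = t v ∧ t v * t v = t v) ∧
  (∀ v w, Λ.IsVertex v → Λ.IsVertex w → v ≠ w → t v * t w = 0) ∧
  (∀ lam mu, Λ.s lam = Λ.r mu → t lam * t mu = t (Λ.comp lam mu)) ∧
  (∀ lam mu, star (t lam) * t mu = ∑ᶠ p ∈ Λ.Lmin lam mu, t p.1 * star (t p.2))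

/-- A relative Cuntz-Krieger `(Λ;𝓔)`-family: (TCK1)--(TCK3) together with (CK). -/
def RCKFamily (𝓔 : Set (Set Λ.Path)) (t : Λ.Path → A) : Prop :=
  Λ.TCKFamily t ∧ ∀ E ∈ 𝓔, ∀ v, Λ.FEat v E → Λ.gapProd t v E = 0

/-- `Θ(t)^{ΠE}_{λ,μ} = t_λ (∏_{λν ∈ ΠE, d(ν) > 0} (t_{s(λ)} - t_ν t_ν*)) t_μ*`. -/
noncomputable def Theta (t : Λ.Path → A) (E : Set Λ.Path) (lam mu : Λ.Path) : A :=
  t lam *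
    listProd {nu | Λ.s lam = Λ.r nu ∧ ¬ Λ.IsVertex nu ∧ Λ.comp lam nu ∈ Λ.PiSet E}
      (fun nu => t (Λ.s lam) - t nu * star (t nu)) *
    star (t mu)

end StarAlgebra

end KGraph

/-- A graph morphism `x : Ω_{k,m} → Λ`, encoded by its length `m = d(x) ∈ (ℕ∪{∞})^k`
and its values `x(p,q)` on the morphisms `(p,q)` of `Ω_{k,m}` (with the junk value
`x(0,0)` outside the meaningful domain, so graph morphisms are extensional). -/
structure GMor {k : ℕ} (Λ : KGraph k) where
  len : Fin k → ℕ∞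
  seg : (Fin k → ℕ) → (Fin k → ℕ) → Λ.Path
  d_seg : ∀ p q, p ≤ q → (∀ i, (q i : ℕ∞) ≤ len i) → Λ.d (seg p q) = q - p
  r_seg : ∀ p q, p ≤ q → (∀ i, (q i : ℕ∞) ≤ len i) → Λ.r (seg p q) = seg p p
  s_seg : ∀ p q, p ≤ q → (∀ i, (q i : ℕ∞) ≤ len i) → Λ.s (seg p q) = seg q q
  comp_seg : ∀ p q u, p ≤ q → q ≤ u → (∀ i, (u i : ℕ∞) ≤ len i) →
    Λ.comp (seg p q) (seg q u) = seg p u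
  seg_junk : ∀ p q, ¬ (p ≤ q ∧ ∀ i, (q i : ℕ∞) ≤ len i) → seg p q = seg 0 0

namespace GMor

variable {k : ℕ} {Λ : KGraph k}

/-- The range `r(x) = x(0)` of a graph morphism. -/
def range (x : GMor Λ) : Λ.Path := x.seg 0 0

/-- `y = x|_n^{d(x)}`, the restriction of `x` (defined for `n ≤ d(x)`):
`d(y) = d(x) - n` and `y(p,q) = x(n+p, n+q)`. -/
def IsRestriction (y x : GMor Λ) (n : Fin k → ℕ) : Prop :=
  (∀ i, y.len i = x.len i - (n i : ℕ∞)) ∧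
  ∀ p q, p ≤ q → (∀ i, (q i : ℕ∞) ≤ y.len i) → y.seg p q = x.seg (n + p) (n + q)

/-- `y = λx`, the extension of `x` by `λ ∈ Λ r(x)`: `d(y) = d(λ) + d(x)`,
`y(0, d(λ)) = λ` and `y(d(λ), d(λ)+n) = x(0,n)` for `n ≤ d(x)`. -/
def IsExtension (y : GMor Λ) (lam : Λ.Path) (x : GMor Λ) : Prop :=
  (∀ i, y.len i = (Λ.d lam i : ℕ∞) + x.len i) ∧
  y.seg 0 (Λ.d lam) = lam ∧
  ∀ n : Fin k → ℕ, (∀ i, (n i : ℕ∞) ≤ x.len i) →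
    y.seg (Λ.d lam) (Λ.d lam + n) = x.seg 0 n

/-- `x ∈ FΛ^∞`: `x` has an initial segment belonging to `F`. -/
def HasInit (x : GMor Λ) (F : Set Λ.Path) : Prop :=
  ∃ lam ∈ F, (∀ i, (Λ.d lam i : ℕ∞) ≤ x.len i) ∧ x.seg 0 (Λ.d lam) = lam

/-- `z` restricts to `x` on `Ω_{k, d(x)}`. -/
def Agrees (z x : GMor Λ) : Prop :=
  ∀ p q, p ≤ q → (∀ i, (q i : ℕ∞) ≤ x.len i) → z.seg p q = x.seg p q

/-- `z ∈ MCE(x,y)` for graph morphisms `x, y`. -/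
def IsMCE (z x y : GMor Λ) : Prop :=
  (∀ i, z.len i = max (x.len i) (y.len i)) ∧ z.Agrees x ∧ z.Agrees y

/-- `x` is aperiodic: for distinct `λ, μ ∈ Λ r(x)`, `MCE(λx, μx) = ∅`. -/
def Aperiodic (x : GMor Λ) : Prop :=
  ∀ lam mu : Λ.Path, lam ≠ mu → Λ.s lam = x.range → Λ.s mu = x.range →
    ∀ lx mx : GMor Λ, lx.IsExtension lam x → mx.IsExtension mu x →
      ∀ z : GMor Λ, ¬ z.IsMCE lx mx

end GMor

namespace KGraph

variable {k : ℕ} (Λ : KGraph k)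

/-- `x ∈ ∂(Λ;𝓔)`: an `𝓔`-compatible boundary path. -/
def IsBdry (𝓔 : Set (Set Λ.Path)) (x : GMor Λ) : Prop :=
  ∀ n : Fin k → ℕ, (∀ i, (n i : ℕ∞) ≤ x.len i) →
    ∀ E ∈ 𝓔, Λ.FEat (x.seg n n) E →
      ∃ lam ∈ E, (∀ i, ((n + Λ.d lam) i : ℕ∞) ≤ x.len i) ∧ x.seg n (n + Λ.d lam) = lam

/-- Condition (C): aperiodic `𝓔`-compatible boundary paths out of every vertex, and
avoiding any given `F ∈ vFE(Λ) \ 𝓔`. -/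
def CondC (𝓔 : Set (Set Λ.Path)) : Prop :=
  (∀ v, Λ.IsVertex v → ∃ x : GMor Λ, Λ.IsBdry 𝓔 x ∧ x.range = v ∧ x.Aperiodic) ∧
  (∀ v F, Λ.FEat v F → F ∉ 𝓔 →
    ∃ x : GMor Λ, Λ.IsBdry 𝓔 x ∧ x.range = v ∧ ¬ x.HasInit F ∧ x.Aperiodic)

end KGraph

namespace KGraph

variable {k : ℕ} {Λ : KGraph k}

/-- The factorisation `λ = λ(0,m) λ(m,d(λ))` is the only one with first factor of degree `m`. -/
theorem split_comp {nu b : Λ.Path} (h : Λ.s nu = Λ.r b) :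
    Λ.split (Λ.comp nu b) (Λ.d nu) = (nu, b) := by
  have hd : Λ.d (Λ.comp nu b) = Λ.d nu + Λ.d b := Λ.d_comp nu b h
  have hle : Λ.d nu ≤ Λ.d (Λ.comp nu b) := by
    rw [hd]
    exact le_self_add
  have hsub : Λ.d (Λ.comp nu b) - Λ.d nu = Λ.d b := by
    rw [hd]
    exact add_tsub_cancel_left _ _
  have hf := Λ.factor (Λ.comp nu b) (Λ.d nu) (Λ.d (Λ.comp nu b) - Λ.d nu)
    (by rw [hsub, hd])
  rw [split, dif_pos hle]
  exact hf.unique (Exists.choose_spec hf).1 ⟨h, rfl, hsub.symm, rfl⟩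

/-- The initial segment of `νβ` of degree `d(ν)` is `ν`. -/
theorem seg_zero_comp {nu b : Λ.Path} (h : Λ.s nu = Λ.r b) :
    Λ.seg (Λ.comp nu b) 0 (Λ.d nu) = nu := by
  have h0 := split_comp (Λ := Λ) (Λ.s_r nu)
  rw [Λ.range_comp, Λ.d_r] at h0
  rw [seg, split_comp h, h0]

theorem Ext_mono (mu : Λ.Path) {E F : Set Λ.Path} (h : E ⊆ F) : Λ.Ext mu E ⊆ Λ.Ext mu F :=
  fun _ ⟨hr, nu, hnu, b, hb⟩ => ⟨hr, nu, h hnu, b, hb⟩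

theorem lamSet_Ext_subset_setLam (mu : Λ.Path) (F : Set Λ.Path) :
    Λ.lamSet mu (Λ.Ext mu F) ⊆ Λ.setLam F := by
  rintro x ⟨a, ⟨-, nu, hnu, b, hmin⟩, -, rfl⟩
  exact ⟨nu, hnu, b, hmin.2.1, hmin.2.2.1.symm⟩

theorem FEat.nonempty {v : Λ.Path} {E : Set Λ.Path} (hv : Λ.r v = v) (h : Λ.FEat v E) :
    E.Nonempty := by
  obtain ⟨_, _, nu, hnu, _⟩ := h.2.2.2 v hv
  exact ⟨nu, hnu⟩

/-- A path of degree `0` is its own range. -/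
theorem IsVertex.r_eq {v : Λ.Path} (hv : Λ.IsVertex v) : Λ.r v = v := by
  have hf := Λ.factor v 0 0 (by rw [hv, add_zero])
  have h : (Λ.r v, v) = (v, Λ.s v) := hf.unique
    ⟨Λ.s_r v, Λ.d_r v, hv, Λ.range_comp v⟩
    ⟨(Λ.r_s v).symm, hv, Λ.d_s v, Λ.comp_source v⟩
  exact congrArg Prod.fst h

/-- If every element of a finite exhaustive set has range `v`, then it is exhaustive at `v`. -/
theorem FEat_of_mem_FE {v : Λ.Path} {E : Set Λ.Path} (hE : E ∈ Λ.FE)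
    (hr : ∀ lam ∈ E, Λ.r lam = v) : Λ.FEat v E := by
  obtain ⟨w, hw⟩ := hE
  obtain ⟨lam, hlam⟩ := hw.nonempty hw.1.r_eq
  rwa [← (hw.2.1 lam hlam).1.symm.trans (hr lam hlam)]

/-- A finite set of paths of nonzero degree with range `v` belongs to a satiated `𝓔` as soon as
some `G ∈ 𝓔` consists of extensions of its elements. -/
theorem Satiated.mem_of_subset_setLam {𝓔 : Set (Set Λ.Path)} (h𝓔 : Λ.Satiated 𝓔)
    {v : Λ.Path} {F G : Set Λ.Path} (hFfin : F.Finite)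
    (hF : ∀ lam ∈ F, Λ.r lam = v ∧ ¬ Λ.IsVertex lam) (hG : G ∈ 𝓔) (hGF : G ⊆ Λ.setLam F) :
    F ∈ 𝓔 := by
  obtain ⟨hFE, hS1, -, hS3, -⟩ := h𝓔
  have hinit : ∀ lam, ∃ nu, lam ∈ G →
      nu ∈ F ∧ Λ.d nu ≤ Λ.d lam ∧ Λ.seg lam 0 (Λ.d nu) = nu := by
    intro lam
    by_cases hlam : lam ∈ G
    · obtain ⟨nu, hnu, b, hb, rfl⟩ := hGF hlam
      refine ⟨nu, fun _ => ⟨hnu, ?_, seg_zero_comp hb⟩⟩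
      rw [Λ.d_comp nu b hb]
      exact le_self_add
    · exact ⟨lam, fun h => absurd h hlam⟩
  choose f hf using hinit
  have hH := hS3 G hG (fun lam => Λ.d (f lam)) fun lam hlam =>
    ⟨pos_iff_ne_zero.2 (hF _ (hf lam hlam).1).2, (hf lam hlam).2.1⟩
  have hHF : (fun lam => Λ.seg lam 0 (Λ.d (f lam))) '' G ⊆ F := by
    rintro _ ⟨lam, hlam, rfl⟩
    simpa only [(hf lam hlam).2.2] using (hf lam hlam).1
  obtain ⟨hv, -, -, hex⟩ := FEat_of_mem_FE (hFE hH) fun lam hlam => (hF lam (hHF hlam)).1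
  refine hS1 _ hH F ⟨v, hv, fun lam hlam => ⟨(hF lam hlam).1, ?_⟩, hFfin, fun lam hlam => ?_⟩ hHF
  · rintro rfl
    exact (hF lam hlam).2 hv
  · exact (hex lam hlam).mono (Ext_mono lam hHF)

end KGraph

/-- Lemma 4.9: if `E ∈ 𝓔` and `F ⊆ r(E)Λ \ Λ⁰` is finite with every
`μ ∈ E` satisfying `μ ∈ FΛ` or `Ext(μ;F) ∈ 𝓔`, then `F ∈ 𝓔`. -/
theorem statement6 {k : ℕ} (Λ : KGraph k) (hΛ : Λ.FinitelyAligned)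
    (𝓔 : Set (Set Λ.Path)) (h𝓔 : Λ.Satiated 𝓔)
    (E : Set Λ.Path) (hE𝓔 : E ∈ 𝓔) (v : Λ.Path) (hEv : Λ.FEat v E)
    (F : Set Λ.Path) (hFfin : F.Finite)
    (hFsub : ∀ lam ∈ F, Λ.r lam = v ∧ ¬ Λ.IsVertex lam)
    (hyp : ∀ mu ∈ E, mu ∈ Λ.setLam F ∨ Λ.Ext mu F ∈ 𝓔) :
    F ∈ 𝓔 := by
  refine h𝓔.mem_of_subset_setLam hFfin hFsub
    (h𝓔.2.2.2.2 E hE𝓔 {mu ∈ E | mu ∉ Λ.setLam F} (Set.sep_subset _ _) (fun mu => Λ.Ext mu F) ?_) ?_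
  · rintro mu ⟨hmu, hmuF⟩
    have hExt := (hyp mu hmu).resolve_left hmuF
    exact ⟨hExt, KGraph.FEat_of_mem_FE (h𝓔.1 hExt) fun lam hlam => hlam.1⟩
  · refine Set.union_subset ?_ (Set.iUnion₂_subset fun mu _ =>
      KGraph.lamSet_Ext_subset_setLam mu F)
    rintro mu ⟨hmu, hmuF⟩
    by_contra h
    exact hmuF ⟨hmu, h⟩
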